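/- arXiv:1303.3993 — 2 statements merged into one kernel-verified Lean document; each statement's English description precedes it below -/
import Mathlib

section
/- Let f : ℤ → ℝ be nonnegative with bounded variation and fix a system of peaks as in the context. Let 0 ≤ N ≤ 11, 0 ≤ K ≤ 299, and set L_N = 2^{N−6} if N ≥ 6 and L_N = 2^{N+6} if N ≤ 5. Let S be a finite set of pairs (n,k) with n ≥ 6, n ≡ N (mod 12), k ≡ K (mod 300), such that for each (n,k) ∈ S the class E^n_k is nonempty and satisfies alternative A. Then there exist an integer m ≥ 0 and integers x_1 < u_1 < v_1 < x_2 < u_2 < v_2 < … < x_m < u_m < v_m < x_{m+1} with u_i − x_i ≥ L_N, v_i − u_i ≥ L_N, and x_{i+1} − v_i ≥ L_N for 1 ≤ i ≤ m, such that ∑_{i=1}^m ( f(x_i) + f(x_{i+1}) − 2·A_{u_i,v_i}f ) ≥ (1/60)·∑_{(n,k)∈S} Var E^n_k. -/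
open Finset

noncomputable section

/-- Average of `f : ℤ → ℝ` over the integer interval `[x, y]`:
`A_{x,y} f = (1/(y-x+1)) ∑_{k=x}^{y} f(k)`. -/
def avg (f : ℤ → ℝ) (x y : ℤ) : ℝ :=
  (∑ k ∈ Finset.Icc x y, f k) / ((y - x + 1 : ℤ) : ℝ)

/-- The discrete centered Hardy–Littlewood maximal function
`Mf(n) = sup_{r ≥ 0} (1/(2r+1)) ∑_{k=-r}^{r} |f(n+k)|`. -/
def dM (f : ℤ → ℝ) (n : ℤ) : ℝ :=
  ⨆ r : ℕ, avg (fun k => |f k|) (n - r) (n + r)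

/-- The total variation `Var f = ∑_{k ∈ ℤ} |f(k+1) - f(k)|`. -/
def dVar (f : ℤ → ℝ) : ℝ := ∑' k : ℤ, |f (k + 1) - f k|

/-- `f` has bounded variation. -/
def BddVar (f : ℤ → ℝ) : Prop := Summable fun k : ℤ => |f (k + 1) - f k|

/-- A peak for `f`: integers `p < r < q` with `Mf(p) < Mf(r)` and `Mf(q) < Mf(r)`. -/
def IsPeak (f : ℤ → ℝ) (p r q : ℤ) : Prop :=
  p < r ∧ r < q ∧ dM f p < dM f r ∧ dM f q < dM f r

/-- The variation of a peak `{p < r < q}`: `2·Mf(r) - Mf(p) - Mf(q)`. -/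
def peakVar (f : ℤ → ℝ) (p r q : ℤ) : ℝ := 2 * dM f r - dM f p - dM f q

/-- An essential peak: `max_{p<k<q} f(k) ≤ Mf(r) - (1/4)·Var{p,r,q}`. -/
def IsEssentialPeak (f : ℤ → ℝ) (p r q : ℤ) : Prop :=
  IsPeak f p r q ∧
    ∀ k : ℤ, p < k → k < q → f k ≤ dM f r - (1 / 4) * peakVar f p r q

/-- `w` is the radius `ω(r)` of an (essential) peak with center `r`:
the largest integer `w > 0` with `A_w f(r) = Mf(r)`. -/
def IsRadius (f : ℤ → ℝ) (r w : ℤ) : Prop :=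
  0 < w ∧ avg f (r - w) (r + w) = dM f r ∧
    ∀ w' : ℤ, 0 < w' → avg f (r - w') (r + w') = dM f r → w' ≤ w

open scoped Classical

/-- The class `E^n_k` of (indices of) essential peaks `𝕡_i = {a_i < b_i < a_{i+1}}`
of the fixed system with radius `2^{n-1} < ω(b_i) ≤ 2^n` and
`k·2^{n-5} < b_i ≤ (k+1)·2^{n-5}`. -/
def Enk (f : ℤ → ℝ) (a b : ℕ → ℤ) (σ n : ℕ) (k : ℤ) : Finset ℕ :=
  (Finset.Icc 1 σ).filter fun i =>
    IsEssentialPeak f (a i) (b i) (a (i + 1)) ∧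
    ∃ w : ℤ, IsRadius f (b i) w ∧ 2 ^ (n - 1) < w ∧ w ≤ 2 ^ n ∧
      k * 2 ^ (n - 5) < b i ∧ b i ≤ (k + 1) * 2 ^ (n - 5)

/-- `Var E^n_k`, the total variation of the peaks in the class `E^n_k`. -/
def varEnk (f : ℤ → ℝ) (a b : ℕ → ℤ) (σ n : ℕ) (k : ℤ) : ℝ :=
  ∑ i ∈ Enk f a b σ n k, peakVar f (a i) (b i) (a (i + 1))

/-- Alternative A of Lemma 5, for the class indexed by `(n,k)`, with `V = Var E^n_k`. -/
def AltA (f : ℤ → ℝ) (n : ℕ) (k : ℤ) (V : ℝ) : Prop :=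
  ∃ s α β γ δ t : ℤ, s < α ∧ α < β ∧ β < γ ∧ γ < δ ∧ δ < t ∧
    (k - 64) * 2 ^ (n - 5) ≤ s ∧ t ≤ (k + 65) * 2 ^ (n - 5) ∧
    2 ^ (n - 5) ≤ α - s ∧ 2 ^ (n - 5) ≤ β - α ∧ 2 ^ (n - 4) ≤ γ - β ∧
    2 ^ (n - 5) ≤ δ - γ ∧ 2 ^ (n - 5) ≤ t - δ ∧
    (1 / 24 : ℝ) * V ≤ min (f s) (f t) - max (avg f α β) (avg f γ δ)

/-- Alternative B of Lemma 5, for the class indexed by `(n,k)`, with `V = Var E^n_k`. -/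
def AltB (f : ℤ → ℝ) (n : ℕ) (k : ℤ) (V : ℝ) : Prop :=
  ∃ α β u v γ δ : ℤ, α < β ∧ β < u ∧ u < v ∧ v < γ ∧ γ < δ ∧
    (k - 64) * 2 ^ (n - 5) ≤ α ∧ δ ≤ (k + 65) * 2 ^ (n - 5) ∧
    2 ^ (n - 5) ≤ β - α ∧ 2 ^ (n - 5) ≤ u - β ∧ 2 ^ (n - 5) ≤ v - u ∧
    2 ^ (n - 5) ≤ γ - v ∧ 2 ^ (n - 5) ≤ δ - γ ∧
    (1 / 24 : ℝ) * V ≤ min (avg f α β) (avg f γ δ) - avg f u v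


/-! ### Auxiliary material for the proof -/

/-- Paths: systems `x < u < v < x' < ...` with gaps at least `L`, break points in `B`. -/
inductive Pth (f : ℤ → ℝ) (L : ℤ) (B : Set ℤ) : ℤ → ℤ → ℝ → Prop
  | nil (x : ℤ) : x ∈ B → Pth f L B x x 0
  | cons (x u v y z : ℤ) (w : ℝ) : x ∈ B → u ∈ B → v ∈ B →
      x + L ≤ u → u + L ≤ v → v + L ≤ y → Pth f L B y z w →
      Pth f L B x z (f x + f y - 2 * avg f u v + w)

theorem Pth.mono {f : ℤ → ℝ} {L L' : ℤ} {B B' : Set ℤ} (hL : L' ≤ L) (hB : B ⊆ B')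
    {x y : ℤ} {w : ℝ} (h : Pth f L B x y w) : Pth f L' B' x y w := by
  induction h with
  | nil x hx => exact Pth.nil x (hB hx)
  | cons x u v y z w hx hu hv h1 h2 h3 _ ih =>
    exact Pth.cons x u v y z w (hB hx) (hB hu) (hB hv) (by omega) (by omega) (by omega) ih

theorem Pth.trans {f : ℤ → ℝ} {L : ℤ} {B : Set ℤ}
    {x y z : ℤ} {w w' : ℝ} (h : Pth f L B x y w) (h' : Pth f L B y z w') :
    Pth f L B x z (w + w') := by
  induction h with
  | nil x hx => simpa using h'
  | cons x u v y z w hx hu hv h1 h2 h3 _ ih =>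
    have := Pth.cons x u v y _ _ hx hu hv h1 h2 h3 (ih h')
    rwa [← add_assoc] at this

theorem Pth.head_mem {f : ℤ → ℝ} {L : ℤ} {B : Set ℤ}
    {x y : ℤ} {w : ℝ} (h : Pth f L B x y w) : x ∈ B := by
  cases h <;> assumption

theorem Pth.last_mem {f : ℤ → ℝ} {L : ℤ} {B : Set ℤ}
    {x y : ℤ} {w : ℝ} (h : Pth f L B x y w) : y ∈ B := by
  induction h <;> assumption

/-- Restrict the break point set to one that is separated. -/
theorem Pth.sep {f : ℤ → ℝ} {L : ℤ} (hL : 0 < L) {B : Set ℤ}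
    {x y : ℤ} {w : ℝ} (h : Pth f L B x y w) :
    ∃ B' : Set ℤ, Pth f L B' x y w ∧ (∀ p ∈ B', x ≤ p) ∧
      ∀ p ∈ B', ∀ q ∈ B', p < q → p + L ≤ q := by
  induction h with
  | nil x hx =>
    refine ⟨{x}, Pth.nil x rfl, ?_, ?_⟩
    · rintro p rfl; exact le_rfl
    · rintro p rfl q rfl h; exact absurd h (lt_irrefl _)
  | cons x u v y z w hx hu hv h1 h2 h3 _ ih =>
    obtain ⟨B', hP, hl, hs⟩ := ih
    refine ⟨{x, u, v} ∪ B', Pth.cons x u v y z w (by simp) (by simp) (by simp) h1 h2 h3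
      (hP.mono le_rfl Set.subset_union_right), ?_, ?_⟩
    · rintro p ((rfl | rfl | rfl) | hp)
      · omega
      · omega
      · omega
      · have := hl p hp; omega
    · rintro p ((rfl | rfl | rfl) | hp) q ((rfl | rfl | rfl) | hq) hpq
      all_goals first
        | omega
        | (have := hl _ hq; omega)
        | (have := hl _ hp; omega)
        | exact hs _ hp _ hq hpq

theorem sum_split (f : ℤ → ℝ) (u p v : ℤ) (h1 : u ≤ p) (h2 : p ≤ v) :
    ∑ k ∈ Finset.Icc u v, f k = ∑ k ∈ Finset.Icc u p, f k + ∑ k ∈ Finset.Icc (p + 1) v, f k := by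
  rw [← Finset.sum_union]
  · congr 1
    ext k
    simp only [Finset.mem_Icc, Finset.mem_union]
    omega
  · rw [Finset.disjoint_left]
    intro k
    simp only [Finset.mem_Icc]
    omega

theorem avg_mul (f : ℤ → ℝ) (x y : ℤ) (h : x ≤ y) :
    ∑ k ∈ Finset.Icc x y, f k = avg f x y * ((y : ℝ) - x + 1) := by
  unfold avg
  have h' : (x : ℝ) ≤ y := by exact_mod_cast h
  push_cast
  rw [div_mul_cancel₀]
  linarith

theorem avg_split (f : ℤ → ℝ) (u p v : ℤ) (h1 : u ≤ p) (h2 : p + 1 ≤ v) :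
    avg f u v * ((v : ℝ) - u + 1) =
      avg f u p * ((p : ℝ) - u + 1) + avg f (p + 1) v * ((v : ℝ) - p) := by
  rw [← avg_mul f u v (by omega), ← avg_mul f u p h1, sum_split f u p v h1 (by omega),
    avg_mul f (p + 1) v h2]
  push_cast
  ring

/-- two-piece low average -/
theorem low_two (A H G h g V : ℝ) (hV : 0 ≤ V) (hh : 0 < h) (hg : 3 * h ≤ 7 * g)
    (e : A * (h + g) = H * h + G * g) (hG : A + 7 / 240 * V < G) : H ≤ A - V / 80 := by
  have hg0 : 0 < g := by linarith
  have h1 : (A - H) * h = (G - A) * g := by linarith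
  have h2 : 7 / 240 * V * g ≤ (G - A) * g := mul_le_mul_of_nonneg_right (by linarith) hg0.le
  have h3 : V * (3 * h) ≤ V * (7 * g) := mul_le_mul_of_nonneg_left hg hV
  have h4 : V / 80 * h ≤ (A - H) * h := by nlinarith
  have := le_of_mul_le_mul_right h4 hh
  linarith

theorem low_three (A H G G' h g g' V : ℝ) (hV : 0 ≤ V) (hh : 0 < h) (hg0 : 0 < g) (hg0' : 0 < g')
    (hg : 3 * h ≤ 7 * (g + g'))
    (e : A * (h + g + g') = H * h + G * g + G' * g') (hG : A + 7 / 240 * V < G)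
    (hG' : A + 7 / 240 * V < G') : H ≤ A - V / 80 := by
  have h1 : (A - H) * h = (G - A) * g + (G' - A) * g' := by linarith
  have h2 : 7 / 240 * V * g ≤ (G - A) * g := mul_le_mul_of_nonneg_right (by linarith) hg0.le
  have h2' : 7 / 240 * V * g' ≤ (G' - A) * g' := mul_le_mul_of_nonneg_right (by linarith) hg0'.le
  have h3 : V * (3 * h) ≤ V * (7 * (g + g')) := mul_le_mul_of_nonneg_left hg hV
  have h4 : V / 80 * h ≤ (A - H) * h := by nlinarith
  have := le_of_mul_le_mul_right h4 hh
  linarith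

theorem Pth.one {f : ℤ → ℝ} {L : ℤ} {B : Set ℤ} (x u v y : ℤ)
    (hx : x ∈ B) (hu : u ∈ B) (hv : v ∈ B) (hy : y ∈ B)
    (h1 : x + L ≤ u) (h2 : u + L ≤ v) (h3 : v + L ≤ y) :
    Pth f L B x y (f x + f y - 2 * avg f u v) := by
  have := Pth.cons (f := f) x u v y y 0 hx hu hv h1 h2 h3 (Pth.nil y hy)
  simpa using this

/-- The basic modification of a single step. -/
theorem step_mod (f : ℤ → ℝ) (L : ℤ) (hL : 1 ≤ L) (B : Set ℤ) (V : ℝ) (hV : 0 ≤ V)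
    (x u v y s α β γ δ t : ℤ)
    (hx : x ∈ B) (hu : u ∈ B) (hv : v ∈ B) (hy : y ∈ B)
    (h1 : x + L ≤ u) (h2 : u + L ≤ v) (h3 : v + L ≤ y)
    (hst : t ≤ s + 258 * L) (g1 : s + 2 * L ≤ α) (g2 : α + 2 * L ≤ β) (g3 : β + 4 * L ≤ γ)
    (g4 : γ + 2 * L ≤ δ) (g5 : δ + 2 * L ≤ t)
    (hI : ∀ p, s - 4 * L ≤ p → p ≤ t + 4 * L → p ∈ B)
    (hsub : ∀ p q, (p = x ∨ p = u ∨ p = v ∨ p = y) → (q = x ∨ q = u ∨ q = v ∨ q = y) →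
      s - 128 * L ≤ p → p < q → q ≤ t + 128 * L → False)
    (hA : (1 / 24 : ℝ) * V ≤ min (f s) (f t) - max (avg f α β) (avg f γ δ))
    (hcx : x ≤ β + 2 * L) (hcy : β + 2 * L < y) :
    ∃ w, f x + f y - 2 * avg f u v + V / 40 ≤ w ∧ Pth f L B x y w := by
  have k1 : V / 24 ≤ f s - avg f α β := by
    have a1 := min_le_left (f s) (f t)
    have a2 := le_max_left (avg f α β) (avg f γ δ)
    linarith
  have k2 : V / 24 ≤ f t - avg f γ δ := by
    have a1 := min_le_right (f s) (f t)
    have a2 := le_max_right (avg f α β) (avg f γ δ)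
    linarith
  have hLr : (1 : ℝ) ≤ L := by exact_mod_cast hL
  have xu := hsub x u (by simp) (by simp)
  have xv := hsub x v (by simp) (by simp)
  have uv := hsub u v (by simp) (by simp)
  have vy := hsub v y (by simp) (by simp)
  have bs : s ∈ B := hI s (by omega) (by omega)
  have bα : α ∈ B := hI α (by omega) (by omega)
  have bβ : β ∈ B := hI β (by omega) (by omega)
  have bγ : γ ∈ B := hI γ (by omega) (by omega)
  have bδ : δ ∈ B := hI δ (by omega) (by omega)
  have bt : t ∈ B := hI t (by omega) (by omega)
  -- insertion on the left of the interval
  by_cases c1 : t + L ≤ u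
  · refine ⟨_, ?_, (Pth.one x γ δ t hx bγ bδ bt (by omega) (by omega) (by omega)).trans
      (Pth.one t u v y bt hu hv hy (by omega) (by omega) (by omega))⟩
    linarith
  by_cases c2 : v + L ≤ s
  · refine ⟨_, ?_, (Pth.one x u v s hx hu hv bs (by omega) (by omega) (by omega)).trans
      (Pth.one s α β y bs bα bβ hy (by omega) (by omega) (by omega))⟩
    linarith
  have hxs : x < s - 128 * L := by
    by_contra hc
    exact xu (by omega) (by omega) (by omega)
  have hyt : t + 128 * L < y := by
    by_contra hc
    exact vy (by omega) (by omega) (by omega)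
  have bl : s - 2 * L - 1 ∈ B := hI _ (by omega) (by omega)
  have bp : s - 2 * L ∈ B := hI _ (by omega) (by omega)
  have bq : t + 2 * L ∈ B := hI _ (by omega) (by omega)
  have br : t + 2 * L + 1 ∈ B := hI _ (by omega) (by omega)
  have hstr : (t : ℝ) ≤ s + 258 * L := by exact_mod_cast hst
  by_cases c3 : s - 2 * L - 1 ≤ u + L
  · -- no left part
    have hvt : t + 128 * L < v := by
      by_contra hc
      exact uv (by omega) (by omega) (by omega)
    by_cases c4 : avg f (t + 2 * L + 1) v ≤ avg f u v + 7 / 240 * V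
    · refine ⟨_, ?_, (Pth.one x γ δ t hx bγ bδ bt (by omega) (by omega) (by omega)).trans
        (Pth.one t (t + 2 * L + 1) v y bt br hv hy (by omega) (by omega) (by omega))⟩
      linarith
    · have e := avg_split f u (t + 2 * L) v (by omega) (by omega)
      have r1 : (s : ℝ) - 2 * L - 1 ≤ u + L := by exact_mod_cast c3
      have r2 : (t : ℝ) + 128 * L < v := by exact_mod_cast hvt
      have r3 : (u : ℝ) < t + L := by exact_mod_cast (not_le.mp c1)
      push_cast at e
      have low := low_two (avg f u v) (avg f u (t + 2 * L)) (avg f (t + 2 * L + 1) v)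
        ((t : ℝ) + 2 * L - u + 1) ((v : ℝ) - (t + 2 * L)) V hV (by linarith) (by linarith)
        (by rw [← e]; ring) (not_le.mp c4)
      refine ⟨_, ?_, Pth.one x u (t + 2 * L) y hx hu bq hy (by omega) (by omega) (by omega)⟩
      linarith
  by_cases c5 : v - L ≤ t + 2 * L + 1
  · -- no right part
    have hus : u < s - 128 * L := by
      by_contra hc
      exact uv (by omega) (by omega) (by omega)
    by_cases c4 : avg f u (s - 2 * L - 1) ≤ avg f u v + 7 / 240 * V
    · refine ⟨_, ?_, (Pth.one x u (s - 2 * L - 1) s hx hu bl bs (by omega) (by omega)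
        (by omega)).trans
        (Pth.one s α β y bs bα bβ hy (by omega) (by omega) (by omega))⟩
      linarith
    · have e := avg_split f u (s - 2 * L - 1) v (by omega) (by omega)
      rw [sub_add_cancel] at e
      have r1 : (v : ℝ) - L ≤ t + 2 * L + 1 := by exact_mod_cast c5
      have r2 : (u : ℝ) < s - 128 * L := by exact_mod_cast hus
      have r3 : (s : ℝ) < v + L := by exact_mod_cast (not_le.mp c2)
      push_cast at e
      have low := low_two (avg f u v) (avg f (s - 2 * L) v) (avg f u (s - 2 * L - 1))
        ((v : ℝ) - (s - 2 * L - 1)) ((s : ℝ) - 2 * L - 1 - u + 1) V hV (by linarith) (by linarith)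
        (by linear_combination e) (not_le.mp c4)
      refine ⟨_, ?_, Pth.one x (s - 2 * L) v y hx bp hv hy (by omega) (by omega) (by omega)⟩
      linarith
  by_cases c4 : avg f u (s - 2 * L - 1) ≤ avg f u v + 7 / 240 * V
  · refine ⟨_, ?_, (Pth.one x u (s - 2 * L - 1) s hx hu bl bs (by omega) (by omega)
      (by omega)).trans
      (Pth.one s α β y bs bα bβ hy (by omega) (by omega) (by omega))⟩
    linarith
  by_cases c6 : avg f (t + 2 * L + 1) v ≤ avg f u v + 7 / 240 * V
  · refine ⟨_, ?_, (Pth.one x γ δ t hx bγ bδ bt (by omega) (by omega) (by omega)).trans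
      (Pth.one t (t + 2 * L + 1) v y bt br hv hy (by omega) (by omega) (by omega))⟩
    linarith
  have e := avg_split f u (s - 2 * L - 1) v (by omega) (by omega)
  rw [sub_add_cancel] at e
  have e' := avg_split f (s - 2 * L) (t + 2 * L) v (by omega) (by omega)
  have r1 : (u : ℝ) + L < s - 2 * L - 1 := by exact_mod_cast (not_le.mp c3)
  have r2 : (t : ℝ) + 2 * L + 1 < v - L := by exact_mod_cast (not_le.mp c5)
  have r4 : (s : ℝ) ≤ t := by exact_mod_cast (by omega : s ≤ t)
  have r3 : (126 : ℝ) * L ≤ (s - 2 * L - u) + (v - t - 2 * L) := by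
    have : 126 * L ≤ (s - 2 * L - u) + (v - t - 2 * L) := by
      by_contra hc
      exact uv (by omega) (by omega) (by omega)
    exact_mod_cast this
  push_cast at e e'
  have low := low_three (avg f u v) (avg f (s - 2 * L) (t + 2 * L)) (avg f u (s - 2 * L - 1))
    (avg f (t + 2 * L + 1) v)
    ((t : ℝ) + 2 * L - (s - 2 * L) + 1) ((s : ℝ) - 2 * L - 1 - u + 1) ((v : ℝ) - (t + 2 * L))
    V hV (by linarith) (by linarith) (by linarith) (by linarith)
    (by linear_combination e + e') (not_le.mp c4) (not_le.mp c6)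
  refine ⟨_, ?_, Pth.one x (s - 2 * L) (t + 2 * L) y hx bp bq hy (by omega) (by omega) (by omega)⟩
  linarith

/-- Insertion of one class into a path. -/
theorem path_mod (f : ℤ → ℝ) (L : ℤ) (hL : 1 ≤ L) (B B' : Set ℤ) (hBB : B ⊆ B')
    (V : ℝ) (hV : 0 ≤ V) (s α β γ δ t : ℤ)
    (hst : t ≤ s + 258 * L) (g1 : s + 2 * L ≤ α) (g2 : α + 2 * L ≤ β) (g3 : β + 4 * L ≤ γ)
    (g4 : γ + 2 * L ≤ δ) (g5 : δ + 2 * L ≤ t)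
    (hI : ∀ p, s - 4 * L ≤ p → p ≤ t + 4 * L → p ∈ B')
    (hsub : ∀ p ∈ B, ∀ q ∈ B, s - 128 * L ≤ p → p < q → q ≤ t + 128 * L → False)
    (hA : (1 / 24 : ℝ) * V ≤ min (f s) (f t) - max (avg f α β) (avg f γ δ))
    (X Y : ℤ) (w : ℝ) (hP : Pth f L B X Y w)
    (hcx : X ≤ β + 2 * L) (hcy : β + 2 * L < Y) :
    ∃ w', w + V / 40 ≤ w' ∧ Pth f L B' X Y w' := by
  induction hP with
  | nil x hx => omega
  | cons x u v y z w hx hu hv h1 h2 h3 hP ih =>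
    by_cases c : y ≤ β + 2 * L
    · obtain ⟨w', hw', hP'⟩ := ih c hcy
      refine ⟨_, ?_, Pth.cons x u v y z w' (hBB hx) (hBB hu) (hBB hv) h1 h2 h3 hP'⟩
      linarith
    · have hy := hP.head_mem
      obtain ⟨w', hw', hP'⟩ := step_mod f L hL B' V hV x u v y s α β γ δ t (hBB hx) (hBB hu)
        (hBB hv) (hBB hy) h1 h2 h3 hst g1 g2 g3 g4 g5 hI
        (by
          intro p q hp hq
          apply hsub p _ q _
          · rcases hp with rfl | rfl | rfl | rfl <;> assumption
          · rcases hq with rfl | rfl | rfl | rfl <;> assumption)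
        hA hcx (by omega)
      refine ⟨_, ?_, hP'.trans (hP.mono le_rfl hBB)⟩
      linarith

/-- One scale. -/
theorem scale_mod (f : ℤ → ℝ) (L : ℤ) (hL : 1 ≤ L) (n : ℕ) (hn : 6 ≤ n) (hLn : L = 2 ^ (n - 6))
    (X Y : ℤ) (w : ℝ) (B₀ : Set ℤ) (hP : Pth f (4096 * L) B₀ X Y w) (K : ℤ) (V : ℤ → ℝ)
    (Q : Finset ℤ)
    (hQ : ∀ k ∈ Q, k % 300 = K ∧ 0 ≤ V k ∧ AltA f n k (V k) ∧
      X ≤ (k - 64) * (2 * L) ∧ (k + 65) * (2 * L) ≤ Y) :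
    ∃ w' B', w + (∑ k ∈ Q, V k) / 40 ≤ w' ∧ Pth f L B' X Y w' := by
  obtain ⟨B, hPB, -, hsep⟩ := hP.sep (by omega)
  have key : ∀ Q' : Finset ℤ, Q' ⊆ Q → ∃ w', w + (∑ k ∈ Q', V k) / 40 ≤ w' ∧
      Pth f L (B ∪ {p | ∃ k ∈ Q', (k - 64) * (2 * L) - 4 * L ≤ p ∧
        p ≤ (k + 65) * (2 * L) + 4 * L}) X Y w' := by
    intro Q'
    induction Q' using Finset.induction_on with
    | empty =>
      intro _
      exact ⟨w, by simp, hPB.mono (by omega) Set.subset_union_left⟩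
    | insert k Q' hk ih =>
      intro hsubQ
      obtain ⟨w', hw', hP'⟩ := ih (fun j hj => hsubQ (Finset.mem_insert_of_mem hj))
      obtain ⟨hkK, hVk, ⟨s, α, β, γ, δ, t, o1, o2, o3, o4, o5, q1, q2, g1, g2, g3, g4, g5, hA⟩,
        hX, hY⟩ := hQ k (hsubQ (Finset.mem_insert_self _ _))
      have p5 : (2 : ℤ) ^ (n - 5) = 2 * L := by
        rw [hLn, show n - 5 = (n - 6) + 1 by omega, pow_succ]; ring
      have p4 : (2 : ℤ) ^ (n - 4) = 4 * L := by
        rw [hLn, show n - 4 = (n - 6) + 2 by omega, pow_add]; ring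
      rw [p5] at q1 q2 g1 g2 g4 g5
      rw [p4] at g3
      obtain ⟨w'', hw'', hP''⟩ := path_mod f L hL _
        (B ∪ {p | ∃ j ∈ insert k Q', (j - 64) * (2 * L) - 4 * L ≤ p ∧
          p ≤ (j + 65) * (2 * L) + 4 * L})
        (by
          apply Set.union_subset_union_right
          rintro p ⟨j, hj, hp⟩
          exact ⟨j, Finset.mem_insert_of_mem hj, hp⟩)
        (V k) hVk s α β γ δ t (by linarith) (by linarith) (by linarith) (by linarith)
        (by linarith) (by linarith)
        (by
          intro p h1 h2
          exact Or.inr ⟨k, Finset.mem_insert_self _ _, by linarith, by linarith⟩)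
        (by
          have far : ∀ p, (p ∈ B ∪ {p | ∃ k ∈ Q', (k - 64) * (2 * L) - 4 * L ≤ p ∧
              p ≤ (k + 65) * (2 * L) + 4 * L}) → s - 128 * L ≤ p → p ≤ t + 128 * L → p ∈ B := by
            rintro p (hp | ⟨j, hj, hp1, hp2⟩) h1 h2
            · exact hp
            · exfalso
              have hjK := (hQ j (hsubQ (Finset.mem_insert_of_mem hj))).1
              have hne : j ≠ k := by rintro rfl; exact hk hj
              rcases (by omega : j + 300 ≤ k ∨ k + 300 ≤ j) with h | h
              · nlinarith
              · nlinarith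
          intro p hp q hq h1 h2 h3
          have := hsep p (far p hp h1 (by omega)) q (far q hq (by omega) h3) h2
          linarith)
        hA X Y w' hP' (by linarith) (by linarith)
      refine ⟨w'', ?_, hP''⟩
      rw [Finset.sum_insert hk]
      linarith
  obtain ⟨w', h1, h2⟩ := key Q (Finset.Subset.refl _)
  exact ⟨w', _, h1, h2⟩

theorem exists_limits (f : ℤ → ℝ) (hbv : BddVar f) : ∃ c c' : ℝ, ∀ η > 0, ∃ M : ℤ, 0 ≤ M ∧
    (∀ n, n ≤ -M → |f n - c| ≤ η) ∧ (∀ n, M ≤ n → |f n - c'| ≤ η) := by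
  have h1 : CauchySeq (fun n : ℕ => f n) := by
    apply cauchySeq_of_summable_dist
    have := hbv.comp_injective (i := fun n : ℕ => (n : ℤ)) Nat.cast_injective
    refine this.congr fun n => ?_
    simp [Real.dist_eq, abs_sub_comm]
  have h2 : CauchySeq (fun n : ℕ => f (-n)) := by
    apply cauchySeq_of_summable_dist
    have := hbv.comp_injective (i := fun n : ℕ => -(n : ℤ) - 1)
      (fun a b h => by simpa using h)
    refine this.congr fun n => ?_
    simp only [Function.comp, Real.dist_eq]
    congr 3 <;> push_cast <;> ring_nf
  obtain ⟨c', hc'⟩ := cauchySeq_tendsto_of_complete h1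
  obtain ⟨c, hc⟩ := cauchySeq_tendsto_of_complete h2
  refine ⟨c, c', fun η hη => ?_⟩
  obtain ⟨M1, hM1⟩ := Metric.tendsto_atTop.mp hc η hη
  obtain ⟨M2, hM2⟩ := Metric.tendsto_atTop.mp hc' η hη
  refine ⟨max M1 M2, by positivity, fun n hn => ?_, fun n hn => ?_⟩
  · have := hM1 (-n).toNat (by omega)
    rw [show -(((-n).toNat : ℕ) : ℤ) = n by omega, Real.dist_eq] at this
    exact this.le
  · have := hM2 n.toNat (by omega)
    rw [show ((n.toNat : ℕ) : ℤ) = n by omega, Real.dist_eq] at this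
    exact this.le

theorem avg_le_of (f : ℤ → ℝ) (u v : ℤ) (huv : u ≤ v) (C : ℝ)
    (h : ∀ k, u ≤ k → k ≤ v → f k ≤ C) : avg f u v ≤ C := by
  have h' : (u : ℝ) ≤ v := by exact_mod_cast huv
  unfold avg
  rw [div_le_iff₀ (by push_cast; linarith)]
  calc ∑ k ∈ Finset.Icc u v, f k ≤ ∑ k ∈ Finset.Icc u v, C :=
        Finset.sum_le_sum fun k hk => h k (Finset.mem_Icc.mp hk).1 (Finset.mem_Icc.mp hk).2
    _ = C * ((v - u + 1 : ℤ) : ℝ) := by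
        rw [Finset.sum_const, Int.card_Icc, nsmul_eq_mul, mul_comm]
        congr 1
        have : (((v + 1 - u).toNat : ℕ) : ℤ) = v - u + 1 := by omega
        exact_mod_cast this

theorem initial_path (f : ℤ → ℝ) (hbv : BddVar f) (D : ℤ) (hD : 1 ≤ D) (lo hi : ℤ) (η : ℝ)
    (hη : 0 < η) : ∃ X Y w, X ≤ lo ∧ hi ≤ Y ∧ -η ≤ w ∧ Pth f D Set.univ X Y w := by
  obtain ⟨c, c', h⟩ := exists_limits f hbv
  obtain ⟨M, hM, hl, hr⟩ := h (η / 4) (by positivity)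
  have m : ∀ p : ℤ, p ∈ (Set.univ : Set ℤ) := fun p => Set.mem_univ p
  rcases le_total c c' with hc | hc
  · have hX := abs_le.mp (hl (-M - |lo| - 2 * D) (by have := abs_nonneg lo; omega))
    have hY := abs_le.mp (hr (M + |hi| + D) (by have := abs_nonneg hi; omega))
    have hAv := avg_le_of f (-M - |lo| - D) (-M - |lo|) (by omega) (c + η / 4)
      (fun k _ hk => by
        have := abs_le.mp (hl k (by have := abs_nonneg lo; omega))
        linarith)
    have a1 := abs_nonneg lo
    have a2 := abs_nonneg hi
    have a3 := neg_abs_le lo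
    have a4 := le_abs_self hi
    refine ⟨_, _, _, ?_, ?_, ?_, Pth.one (-M - |lo| - 2 * D) (-M - |lo| - D) (-M - |lo|)
      (M + |hi| + D) (m _) (m _) (m _) (m _) (by omega) (by omega) (by omega)⟩
    · omega
    · omega
    · linarith
  · have hX := abs_le.mp (hl (-M - |lo| - D) (by have := abs_nonneg lo; omega))
    have hY := abs_le.mp (hr (M + |hi| + 2 * D) (by have := abs_nonneg hi; omega))
    have hAv := avg_le_of f (M + |hi|) (M + |hi| + D) (by omega) (c' + η / 4)
      (fun k hk _ => by
        have := abs_le.mp (hr k (by have := abs_nonneg hi; omega))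
        linarith)
    have a1 := abs_nonneg lo
    have a2 := abs_nonneg hi
    have a3 := neg_abs_le lo
    have a4 := le_abs_self hi
    refine ⟨_, _, _, ?_, ?_, ?_, Pth.one (-M - |lo| - D) (M + |hi|) (M + |hi| + D)
      (M + |hi| + 2 * D) (m _) (m _) (m _) (m _) (by omega) (by omega) (by omega)⟩
    · omega
    · omega
    · linarith

/-- Conversion of a path to indexed sequences. -/
theorem Pth.toSeq {f : ℤ → ℝ} {L : ℤ} {B : Set ℤ} {X Y : ℤ} {w : ℝ} (h : Pth f L B X Y w) :
    ∃ (m : ℕ) (x u v : ℕ → ℤ), x 1 = X ∧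
      (∀ i ∈ Finset.Icc 1 m,
        L ≤ u i - x i ∧ L ≤ v i - u i ∧ L ≤ x (i + 1) - v i) ∧
      ∑ i ∈ Finset.Icc 1 m, (f (x i) + f (x (i + 1)) - 2 * avg f (u i) (v i)) = w := by
  induction h with
  | nil x hx => exact ⟨0, fun _ => x, fun _ => x, fun _ => x, rfl, by simp, by simp⟩
  | cons x₀ u₀ v₀ y z w hx hu hv h1 h2 h3 hP ih =>
    obtain ⟨m, x, u, v, hx1, hg, hs⟩ := ih
    refine ⟨m + 1, fun i => if i ≤ 1 then x₀ else x (i - 1), fun i => if i ≤ 1 then u₀ else u (i - 1),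
      fun i => if i ≤ 1 then v₀ else v (i - 1), by simp, ?_, ?_⟩
    · intro i hi
      rw [Finset.mem_Icc] at hi
      rcases (by omega : i = 1 ∨ 2 ≤ i) with rfl | h
      · simp [hx1]
        omega
      · have := hg (i - 1) (Finset.mem_Icc.mpr ⟨by omega, by omega⟩)
        rw [Nat.sub_add_cancel (by omega)] at this
        simp only [show ¬ i ≤ 1 by omega, show ¬ i + 1 ≤ 1 by omega, if_false,
          Nat.add_sub_cancel]
        exact this
    · rw [← hs, ← Finset.sum_Ioc_add_eq_sum_Icc (by omega)]
      rw [add_comm]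
      congr 1
      · simp [hx1]
      · symm
        refine Finset.sum_bij (fun i _ => i + 1) ?_ ?_ ?_ ?_
        · intro i hi
          simp only [Finset.mem_Icc, Finset.mem_Ioc] at *
          omega
        · intro i _ j _ h
          omega
        · intro i hi
          simp only [Finset.mem_Icc, Finset.mem_Ioc] at *
          exact ⟨i - 1, by omega, by omega⟩
        · intro i hi
          have := (Finset.mem_Icc.mp hi).1
          simp only [show ¬ i + 1 ≤ 1 by omega, show ¬ i + 1 + 1 ≤ 1 by omega, if_false,
            Nat.add_sub_cancel]

/-- Proposition 1 of the paper (classes satisfying alternative A). -/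
theorem stmt11 (f : ℤ → ℝ) (hf : ∀ n, 0 ≤ f n) (hbv : BddVar f)
    (σ : ℕ) (a b : ℕ → ℤ)
    (hab : ∀ i ∈ Finset.Icc 1 σ, a i < b i ∧ b i < a (i + 1))
    (hM : ∀ i ∈ Finset.Icc 1 σ,
      dM f (a i) < dM f (b i) ∧ dM f (a (i + 1)) < dM f (b i))
    (N K : ℕ) (hN : N ≤ 11) (hK : K ≤ 299)
    (LN : ℤ) (hLN : LN = if 6 ≤ N then 2 ^ (N - 6) else 2 ^ (N + 6))
    (S : Finset (ℕ × ℤ))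
    (hS : ∀ c ∈ S, 6 ≤ c.1 ∧ c.1 % 12 = N ∧ c.2 % 300 = (K : ℤ) ∧
      (Enk f a b σ c.1 c.2).Nonempty ∧ AltA f c.1 c.2 (varEnk f a b σ c.1 c.2)) :
    ∃ (m : ℕ) (x u v : ℕ → ℤ),
      (∀ i ∈ Finset.Icc 1 m, x i < u i ∧ u i < v i ∧ v i < x (i + 1)) ∧
      (∀ i ∈ Finset.Icc 1 m,
        LN ≤ u i - x i ∧ LN ≤ v i - u i ∧ LN ≤ x (i + 1) - v i) ∧
      ∑ i ∈ Finset.Icc 1 m, (f (x i) + f (x (i + 1)) - 2 * avg f (u i) (v i)) ≥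
        (1 / 60 : ℝ) * ∑ c ∈ S, varEnk f a b σ c.1 c.2 := by
  obtain rfl | hne := S.eq_empty_or_nonempty
  · exact ⟨0, fun _ => 0, fun _ => 0, fun _ => 0, by simp, by simp, by simp⟩
  obtain ⟨n0, hn0, hn0N, hn0L⟩ : ∃ n0 : ℕ, 6 ≤ n0 ∧ n0 < 18 ∧ n0 % 12 = N ∧ LN = 2 ^ (n0 - 6) := by
    by_cases h : 6 ≤ N
    · exact ⟨N, h, by omega, by omega, by rw [hLN, if_pos h]⟩
    · exact ⟨N + 12, by omega, by omega, by omega, by rw [hLN, if_neg h]; rfl⟩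
  obtain ⟨hn0N', hLN'⟩ := hn0L
  have hLN1 : 1 ≤ LN := by rw [hLN']; exact one_le_pow₀ (by norm_num)
  have hVpos : ∀ c ∈ S, 0 < varEnk f a b σ c.1 c.2 := by
    intro c hc
    obtain ⟨-, -, -, hN, -⟩ := hS c hc
    apply Finset.sum_pos _ hN
    intro i hi
    have := hM i (Finset.mem_filter.mp hi).1
    unfold peakVar
    linarith
  set W := ∑ c ∈ S, varEnk f a b σ c.1 c.2 with hW
  have hWpos : 0 < W := Finset.sum_pos hVpos hne
  obtain ⟨T, hT⟩ : ∃ T : ℕ, ∀ c ∈ S, c.1 < n0 + 12 * T :=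
    ⟨S.sup Prod.fst + 1, fun c hc => by
      have := Finset.le_sup (f := Prod.fst) hc
      omega⟩
  obtain ⟨lo, hlo⟩ : ∃ lo : ℤ, ∀ c ∈ S, lo ≤ (c.2 - 64) * 2 ^ (c.1 - 5) := by
    obtain ⟨lo, hlo⟩ := (S.image fun c => (c.2 - 64) * (2 : ℤ) ^ (c.1 - 5)).bddBelow
    exact ⟨lo, fun c hc => hlo (Finset.mem_coe.mpr (Finset.mem_image_of_mem _ hc))⟩
  obtain ⟨hi, hhi⟩ : ∃ hi : ℤ, ∀ c ∈ S, (c.2 + 65) * 2 ^ (c.1 - 5) ≤ hi := by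
    obtain ⟨hi, hhi⟩ := (S.image fun c => (c.2 + 65) * (2 : ℤ) ^ (c.1 - 5)).bddAbove
    exact ⟨hi, fun c hc => hhi (Finset.mem_coe.mpr (Finset.mem_image_of_mem _ hc))⟩
  obtain ⟨X, Y, w₀, hX, hY, hw₀, hP₀⟩ := initial_path f hbv (LN * 4096 ^ T)
    (by have : (1 : ℤ) ≤ 4096 ^ T := one_le_pow₀ (by norm_num)
        nlinarith) lo hi (W / 120) (by positivity)
  have key : ∀ i j : ℕ, i + j = T → ∃ w B,
      -(W / 120) + (∑ c ∈ S with n0 + 12 * j ≤ c.1, varEnk f a b σ c.1 c.2) / 40 ≤ w ∧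
        Pth f (LN * 4096 ^ j) B X Y w := by
    intro i
    induction i with
    | zero =>
      intro j hj
      obtain rfl : j = T := by omega
      refine ⟨w₀, _, ?_, hP₀⟩
      rw [Finset.filter_false_of_mem (fun c hc => by have := hT c hc; omega)]
      simpa using hw₀
    | succ i ih =>
      intro j hj
      obtain ⟨w, B, hw, hP⟩ := ih (j + 1) (by omega)
      have hpow : LN * 4096 ^ j = 2 ^ (n0 + 12 * j - 6) := by
        rw [hLN', show n0 + 12 * j - 6 = (n0 - 6) + 12 * j by omega, pow_add, pow_mul]
        norm_num
      have h5 : (2 : ℤ) ^ (n0 + 12 * j - 5) = 2 * (LN * 4096 ^ j) := by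
        rw [hpow, show n0 + 12 * j - 5 = (n0 + 12 * j - 6) + 1 by omega, pow_succ]; ring
      obtain ⟨w', B', hw', hP'⟩ := scale_mod f (LN * 4096 ^ j)
        (by rw [hpow]; exact one_le_pow₀ (by norm_num)) (n0 + 12 * j) (by omega) hpow X Y w B
        (by convert hP using 1; ring) K (fun k => varEnk f a b σ (n0 + 12 * j) k)
        ((S.filter fun c => c.1 = n0 + 12 * j).image Prod.snd)
        (by
          intro k hk
          obtain ⟨⟨n, k'⟩, hc, rfl⟩ := Finset.mem_image.mp hk
          obtain ⟨hcS, hn⟩ := Finset.mem_filter.mp hc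
          simp only at hn
          subst hn
          obtain ⟨-, -, hK', -, hA⟩ := hS _ hcS
          refine ⟨hK', (hVpos _ hcS).le, hA, ?_, ?_⟩
          · have := hlo _ hcS
            rw [← h5]
            exact hX.trans this
          · have := hhi _ hcS
            rw [← h5]
            exact this.trans hY)
      refine ⟨w', B', ?_, hP'⟩
      rw [Finset.sum_image (by
        rintro ⟨n, k⟩ h ⟨n', k'⟩ h' e
        have h1 := (Finset.mem_filter.mp h).2
        have h2 := (Finset.mem_filter.mp h').2
        simp only at h1 h2 e
        rw [h1, h2, e])] at hw'
      have e1 : ∑ c ∈ S with c.1 = n0 + 12 * j, varEnk f a b σ (n0 + 12 * j) c.2 =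
          ∑ c ∈ S with c.1 = n0 + 12 * j, varEnk f a b σ c.1 c.2 :=
        Finset.sum_congr rfl fun c hc => by rw [(Finset.mem_filter.mp hc).2]
      have e2 : ∑ c ∈ S with n0 + 12 * j ≤ c.1, varEnk f a b σ c.1 c.2 =
          ∑ c ∈ S with n0 + 12 * (j + 1) ≤ c.1, varEnk f a b σ c.1 c.2 +
          ∑ c ∈ S with c.1 = n0 + 12 * j, varEnk f a b σ c.1 c.2 := by
        rw [← Finset.sum_union]
        · apply Finset.sum_congr _ (fun _ _ => rfl)
          ext c
          simp only [Finset.mem_filter, Finset.mem_union]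
          constructor
          · rintro ⟨hc, h⟩
            have := (hS c hc).2.1
            by_cases h' : c.1 = n0 + 12 * j
            · exact Or.inr ⟨hc, h'⟩
            · exact Or.inl ⟨hc, by omega⟩
          · rintro (⟨hc, h⟩ | ⟨hc, h⟩)
            · exact ⟨hc, by omega⟩
            · exact ⟨hc, by omega⟩
        · rw [Finset.disjoint_left]
          intro c h1 h2
          have h1 := (Finset.mem_filter.mp h1).2
          have h2 := (Finset.mem_filter.mp h2).2
          omega
      rw [e1] at hw'
      rw [e2]
      linarith
  obtain ⟨w, B, hw, hP⟩ := key T 0 (by omega)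
  rw [Finset.filter_true_of_mem (fun c hc => by
    have := hS c hc
    omega), ← hW] at hw
  rw [pow_zero, mul_one] at hP
  obtain ⟨m, x, u, v, -, hg, hs⟩ := hP.toSeq
  refine ⟨m, x, u, v, fun i hi => ?_, hg, ?_⟩
  · have := hg i hi
    omega
  · rw [hs]
    linarith

end
end

section
/- Let f : ℤ → ℝ be nonnegative with bounded variation and fix a system of peaks as in the context. Let S be a finite set of pairs (n,k) with n ≥ 6 such that for each (n,k) ∈ S the class E^n_k is nonempty and satisfies alternative A. Then ∑_{(n,k)∈S} Var E^n_k ≤ 120·2^{12}·300 · Var f. -/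
open Finset

noncomputable section

open scoped Classical

lemma geo_Ico (m M : ℕ) (h : m ≤ M) :
    ∑ n ∈ Finset.Ico m M, (1/2 : ℝ)^n = 2 * (1/2)^m - 2 * (1/2)^M := by
  induction M, h using Nat.le_induction with
  | base => simp
  | succ M h ih => rw [Finset.sum_Ico_succ_top h, ih]; ring

lemma geo_bound (N : Finset ℕ) (c : ℝ) (hc : 0 < c)
    (hN : ∀ n ∈ N, 5 ≤ n ∧ c ≤ 129 * 2^(n-5)) :
    ∑ n ∈ N, (1 / 2^(n-5) : ℝ) ≤ 258 / c := by
  rcases N.eq_empty_or_nonempty with rfl | hne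
  · simp; positivity
  have h1 : ∀ n ∈ N, (1 / 2^(n-5) : ℝ) = 32 * (1/2)^n := by
    intro n hn
    obtain ⟨m, rfl⟩ := Nat.exists_eq_add_of_le (hN n hn).1
    simp [pow_add]; ring
  have hm := N.min'_mem hne
  have hsub : N ⊆ Finset.Ico (N.min' hne) (N.max' hne + 1) := by
    intro n hn
    simp only [Finset.mem_Ico]
    exact ⟨N.min'_le n hn, Nat.lt_succ_of_le (N.le_max' n hn)⟩
  have h2 : ∑ n ∈ N, (1/2 : ℝ)^n ≤ 2 * (1/2)^(N.min' hne) := by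
    refine (Finset.sum_le_sum_of_subset_of_nonneg hsub (fun _ _ _ => by positivity)).trans ?_
    have hmm : N.min' hne ≤ N.max' hne + 1 :=
      Nat.le_succ_of_le (N.min'_le _ (N.max'_mem hne))
    rw [geo_Ico _ _ hmm]
    have : (0:ℝ) ≤ 2 * (1/2)^(N.max' hne + 1) := by positivity
    linarith
  have h3 := h1 _ hm
  have h4 := (hN _ hm).2
  rw [Finset.sum_congr rfl h1, ← Finset.mul_sum]
  have h5 : (1 / 2^(N.min' hne - 5) : ℝ) ≤ 129 / c := by
    rw [div_le_div_iff₀ (by positivity) hc]; linarith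
  calc _ ≤ 2 * (1 / 2^(N.min' hne - 5) : ℝ) := by rw [h3]; linarith
    _ ≤ 2 * (129 / c) := by linarith
    _ = _ := by ring

/-- The points strictly inside the window of `(n,k)`. -/
def win (c : ℕ × ℤ) : Finset ℤ :=
  Finset.Icc ((c.2 - 64) * 2 ^ (c.1 - 5)) ((c.2 + 65) * 2 ^ (c.1 - 5))

lemma win_count (n : ℕ) (K : Finset ℤ) (x : ℤ) :
    (K.filter fun k => x ∈ win (n, k)).card ≤ 131 := by
  have hh : (0:ℤ) < 2^(n-5) := by positivity
  have : (K.filter fun k => x ∈ win (n, k)) ⊆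
      Finset.Icc (x / 2^(n-5) - 65) (x / 2^(n-5) + 65) := by
    intro k hk
    simp only [win, Finset.mem_filter, Finset.mem_Icc] at hk ⊢
    obtain ⟨-, h1, h2⟩ := hk
    have e1 : k - 64 ≤ x / 2^(n-5) := (Int.le_ediv_iff_mul_le hh).2 h1
    have e2 : x / 2^(n-5) ≤ k + 65 := by
      have := Int.ediv_le_ediv hh h2
      rwa [Int.mul_ediv_cancel _ hh.ne'] at this
    omega
  refine (Finset.card_le_card this).trans ?_
  simp; omega

lemma gap_bound (S : Finset (ℕ × ℤ)) (hS : ∀ c ∈ S, 6 ≤ c.1) (p q : ℤ) (hpq : p < q) :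
    ∑ c ∈ S, (if ((q - p : ℤ) : ℝ) ≤ 129 * 2^(c.1-5) then
      (((Finset.Ioo p q).filter (· ∈ win c)).card : ℝ) / 2^(c.1-5) else 0) ≤ 131 * 258 := by
  set L : ℝ := ((q - p : ℤ) : ℝ) with hL
  have hLpos : 0 < L := by rw [hL]; exact_mod_cast sub_pos.2 hpq
  set N := S.image Prod.fst
  set K := S.image Prod.snd
  have hsub : S ⊆ N ×ˢ K := by
    intro c hc
    exact Finset.mem_product.2 ⟨Finset.mem_image_of_mem _ hc, Finset.mem_image_of_mem _ hc⟩
  refine (Finset.sum_le_sum_of_subset_of_nonneg hsub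
    (fun _ _ _ => by split_ifs <;> positivity)).trans ?_
  rw [Finset.sum_product]
  have key : ∀ n, ∑ k ∈ K, (((Finset.Ioo p q).filter (· ∈ win (n,k))).card : ℝ) ≤ 131 * L := by
    intro n
    have e : ∑ k ∈ K, ((Finset.Ioo p q).filter (· ∈ win (n,k))).card
        = ∑ x ∈ Finset.Ioo p q, (K.filter fun k => x ∈ win (n, k)).card := by
      simp only [Finset.card_filter]
      exact Finset.sum_comm
    have e2 : ∑ x ∈ Finset.Ioo p q, (K.filter fun k => x ∈ win (n, k)).card
        ≤ (Finset.Ioo p q).card * 131 :=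
      Finset.sum_le_card_nsmul _ _ _ (fun x _ => win_count n K x)
    have e3 : ((Finset.Ioo p q).card : ℤ) ≤ q - p := by simp; omega
    have e4 : ((Finset.Ioo p q).card : ℝ) ≤ L := by rw [hL]; exact_mod_cast e3
    have e5 : (∑ k ∈ K, (((Finset.Ioo p q).filter (· ∈ win (n,k))).card : ℝ)) ≤
      ((Finset.Ioo p q).card : ℝ) * 131 := by
      rw [← e] at e2; exact_mod_cast e2
    linarith
  calc _ ≤ ∑ n ∈ N, (if L ≤ 129 * 2^(n-5) then (131 * L) * (1 / 2^(n-5)) else 0) := by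
        refine Finset.sum_le_sum fun n _ => ?_
        by_cases h : L ≤ 129 * 2^(n-5)
        · simp only [h, if_true]
          rw [← Finset.sum_div, mul_one_div]
          exact div_le_div_of_nonneg_right (key n) (by positivity)
        · simp [h]
    _ = (131 * L) * ∑ n ∈ N.filter (fun n => L ≤ 129 * 2^(n-5)), (1 / 2^(n-5) : ℝ) := by
        rw [Finset.mul_sum, Finset.sum_filter]
    _ ≤ (131 * L) * (258 / L) := by
        refine mul_le_mul_of_nonneg_left (geo_bound _ L hLpos ?_) (by positivity)
        intro n hn
        obtain ⟨h1, h2⟩ := Finset.mem_filter.1 hn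
        obtain ⟨c, hc, rfl⟩ := Finset.mem_image.1 h1
        exact ⟨by have := hS c hc; omega, h2⟩
    _ = _ := by field_simp

/-- nearest points outside `P` on both sides of `x`. -/
lemma exists_gap (P : ℤ → Prop) (s x t : ℤ) (hsx : s < x) (hxt : x < t)
    (hs : ¬ P s) (ht : ¬ P t) (hx : P x) :
    ∃ p q, s ≤ p ∧ p < x ∧ x < q ∧ q ≤ t ∧ ¬ P p ∧ ¬ P q ∧ ∀ y, p < y → y < q → P y := by
  obtain ⟨p, ⟨hp1, hp2⟩, hp3⟩ := Int.exists_greatest_of_bdd (P := fun z => z ≤ x ∧ ¬ P z)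
    ⟨x, fun z hz => hz.1⟩ ⟨s, hsx.le, hs⟩
  obtain ⟨q, ⟨hq1, hq2⟩, hq3⟩ := Int.exists_least_of_bdd (P := fun z => x ≤ z ∧ ¬ P z)
    ⟨x, fun z hz => hz.1⟩ ⟨t, hxt.le, ht⟩
  refine ⟨p, q, hp3 s ⟨hsx.le, hs⟩, lt_of_le_of_ne hp1 ?_, lt_of_le_of_ne hq1 ?_,
    hq3 t ⟨hxt.le, ht⟩, hp2, hq2, ?_⟩
  · rintro rfl; exact hp2 hx
  · rintro rfl; exact hq2 hx
  · intro y hy1 hy2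
    by_contra hy
    rcases le_total y x with h | h
    · have := hp3 y ⟨h, hy⟩; omega
    · have := hq3 y ⟨h, hy⟩; omega

lemma comb (P : ℤ → Prop) (S : Finset (ℕ × ℤ)) (hS : ∀ c ∈ S, 6 ≤ c.1)
    (s α β t : ℕ × ℤ → ℤ) (W : Finset ℤ)
    (h : ∀ c ∈ S, s c < α c ∧ β c < t c ∧ (c.2 - 64) * 2 ^ (c.1 - 5) ≤ s c ∧
      t c ≤ (c.2 + 65) * 2 ^ (c.1 - 5))
    (hW : ∀ c ∈ S, Finset.Icc (s c) (t c) ⊆ W) :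
    ∑ c ∈ S, (if ¬ P (s c) ∧ ¬ P (t c) then
      (((Finset.Icc (α c) (β c)).filter P).card : ℝ) else 0) / 2^(c.1-5)
    ≤ (131 * 258) * ((W.filter fun p => ¬ P p ∧ P (p+1)).card : ℝ) := by
  set G : Finset (ℤ × ℤ) := (W ×ˢ W).filter fun g =>
    g.1 + 1 < g.2 ∧ ¬ P g.1 ∧ ¬ P g.2 ∧ ∀ y, g.1 < y → y < g.2 → P y with hG
  have hGcard : G.card ≤ (W.filter fun p => ¬ P p ∧ P (p+1)).card := by
    refine Finset.card_le_card_of_injOn Prod.fst ?_ ?_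
    · intro g hg
      simp only [hG, Finset.coe_filter, Finset.mem_product, Set.mem_setOf_eq] at hg
      simp only [Finset.coe_filter, Set.mem_setOf_eq]
      exact ⟨hg.1.1, hg.2.2.1, hg.2.2.2.2 _ (by omega) hg.2.1⟩
    · rintro ⟨p, q⟩ hg ⟨p', q'⟩ hg' hpp
      simp only [hG, Finset.coe_filter, Finset.mem_product, Set.mem_setOf_eq] at hg hg' hpp
      subst hpp
      have : q = q' := by
        rcases lt_trichotomy q q' with h | h | h
        · exact absurd (hg'.2.2.2.2 q (by omega) h) hg.2.2.2.1
        · exact h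
        · exact absurd (hg.2.2.2.2 q' (by omega) h) hg'.2.2.2.1
      rw [this]
  have step : ∀ c ∈ S, (if ¬ P (s c) ∧ ¬ P (t c) then
      (((Finset.Icc (α c) (β c)).filter P).card : ℝ) else 0) / 2^(c.1-5) ≤
      ∑ g ∈ G, (if ((g.2 - g.1 : ℤ) : ℝ) ≤ 129 * 2^(c.1-5) then
      (((Finset.Ioo g.1 g.2).filter (· ∈ win c)).card : ℝ) / 2^(c.1-5) else 0) := by
    intro c hc
    by_cases hP : ¬ P (s c) ∧ ¬ P (t c)
    swap
    · rw [if_neg hP, zero_div]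
      exact Finset.sum_nonneg fun _ _ => by split_ifs <;> positivity
    rw [if_pos hP]
    obtain ⟨h1, h2, h3, h4⟩ := h c hc
    rw [← Finset.sum_filter, ← Finset.sum_div]
    refine div_le_div_of_nonneg_right ?_ (by positivity)
    have hsub : (Finset.Icc (α c) (β c)).filter P ⊆
        (G.filter fun g => ((g.2 - g.1 : ℤ) : ℝ) ≤ 129 * 2^(c.1-5)).biUnion
          fun g => (Finset.Ioo g.1 g.2).filter (· ∈ win c) := by
      intro x hx
      obtain ⟨hx1, hx2⟩ := Finset.mem_filter.1 hx
      rw [Finset.mem_Icc] at hx1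
      obtain ⟨p, q, hp1, hp2, hq1, hq2, hp, hq, hpq⟩ :=
        exists_gap P (s c) x (t c) (by omega) (by omega) hP.1 hP.2 hx2
      refine Finset.mem_biUnion.2 ⟨(p, q), ?_, ?_⟩
      · refine Finset.mem_filter.2 ⟨Finset.mem_filter.2 ⟨Finset.mem_product.2 ⟨?_, ?_⟩, ?_⟩, ?_⟩
        · exact hW c hc (Finset.mem_Icc.2 ⟨hp1, by omega⟩)
        · exact hW c hc (Finset.mem_Icc.2 ⟨by omega, hq2⟩)
        · exact ⟨by simp only; omega, hp, hq, hpq⟩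
        · have : q - p ≤ 129 * 2^(c.1-5) := by linarith
          exact_mod_cast this
      · refine Finset.mem_filter.2 ⟨Finset.mem_Ioo.2 ⟨hp2, hq1⟩, ?_⟩
        rw [win, Finset.mem_Icc]
        constructor <;> linarith
    exact_mod_cast (Finset.card_le_card hsub).trans Finset.card_biUnion_le
  refine (Finset.sum_le_sum step).trans ?_
  rw [Finset.sum_comm]
  have : ∀ g ∈ G, ∑ c ∈ S, (if ((g.2 - g.1 : ℤ) : ℝ) ≤ 129 * 2^(c.1-5) then
      (((Finset.Ioo g.1 g.2).filter (· ∈ win c)).card : ℝ) / 2^(c.1-5) else 0) ≤ 131 * 258 := by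
    intro g hg
    refine gap_bound S hS g.1 g.2 ?_
    have := (Finset.mem_filter.1 hg).2.1
    omega
  refine (Finset.sum_le_card_nsmul _ _ _ this).trans ?_
  rw [nsmul_eq_mul, mul_comm]
  exact mul_le_mul_of_nonneg_left (by exact_mod_cast hGcard) (by norm_num)

lemma ico_int (u v : ℝ) : MeasureTheory.Integrable ((Set.Ico u v).indicator (fun _ => (1:ℝ))) := by
  rw [MeasureTheory.integrable_indicator_iff measurableSet_Ico]
  exact MeasureTheory.integrableOn_const (by simp)

lemma ico_val (u v : ℝ) : ∫ l, (Set.Ico u v).indicator (fun _ => (1:ℝ)) l = max (v - u) 0 := by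
  rw [MeasureTheory.integral_indicator measurableSet_Ico]
  simp [max_comm]

lemma layer (f : ℤ → ℝ) (S : Finset (ℕ × ℤ)) (hS : ∀ c ∈ S, 6 ≤ c.1)
    (s α β t : ℕ × ℤ → ℤ) (W : Finset ℤ)
    (h : ∀ c ∈ S, s c < α c ∧ β c < t c ∧ (c.2 - 64) * 2 ^ (c.1 - 5) ≤ s c ∧
      t c ≤ (c.2 + 65) * 2 ^ (c.1 - 5))
    (hW : ∀ c ∈ S, Finset.Icc (s c) (t c) ⊆ W) :
    ∑ c ∈ S, (∑ x ∈ Finset.Icc (α c) (β c), max (min (f (s c)) (f (t c)) - f x) 0) / 2^(c.1-5)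
    ≤ (131 * 258) * ∑ p ∈ W, max (f p - f (p+1)) 0 := by
  have hI1 : MeasureTheory.Integrable (fun l : ℝ => ∑ c ∈ S, (∑ x ∈ Finset.Icc (α c) (β c),
      (Set.Ico (f x) (min (f (s c)) (f (t c)))).indicator (fun _ => (1:ℝ)) l) / 2^(c.1-5)) :=
    MeasureTheory.integrable_finset_sum _ fun c _ =>
      (MeasureTheory.integrable_finset_sum _ fun x _ => ico_int _ _).div_const _
  have hI2 : MeasureTheory.Integrable (fun l : ℝ => (131 * 258) * ∑ p ∈ W,
      (Set.Ico (f (p+1)) (f p)).indicator (fun _ => (1:ℝ)) l) :=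
    (MeasureTheory.integrable_finset_sum _ fun x _ => ico_int _ _).const_mul _
  have hmono := MeasureTheory.integral_mono hI1 hI2 (fun l => by
    have hc := comb (fun x => f x ≤ l) S hS s α β t W h hW
    simp only [not_le] at hc
    have hr : ∑ p ∈ W, (Set.Ico (f (p+1)) (f p)).indicator (fun _ => (1:ℝ)) l =
        ((W.filter fun p => l < f p ∧ f (p+1) ≤ l).card : ℝ) := by
      rw [Finset.card_filter]
      push_cast
      refine Finset.sum_congr rfl fun p _ => ?_
      simp only [Set.indicator_apply, Set.mem_Ico, and_comm]
    simp only [hr]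
    refine le_trans (le_of_eq ?_) hc
    refine Finset.sum_congr rfl fun c _ => ?_
    congr 1
    by_cases hl : l < f (s c) ∧ l < f (t c)
    · rw [if_pos hl, Finset.card_filter]
      push_cast
      refine Finset.sum_congr rfl fun p _ => ?_
      simp [Set.indicator_apply, hl]
    · rw [if_neg hl]
      refine Finset.sum_eq_zero fun p _ => ?_
      rw [Set.indicator_of_notMem]
      intro hm
      exact hl (lt_min_iff.1 hm.2))
  rw [MeasureTheory.integral_const_mul, MeasureTheory.integral_finset_sum _
    (fun _ _ => ico_int _ _), MeasureTheory.integral_finset_sum _ (fun c _ =>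
      (MeasureTheory.integrable_finset_sum _ fun x _ => ico_int _ _).div_const _)] at hmono
  simp only [MeasureTheory.integral_div, ico_val] at hmono
  refine le_trans (le_of_eq ?_) hmono
  refine Finset.sum_congr rfl fun c _ => ?_
  rw [MeasureTheory.integral_finset_sum _ (fun _ _ => ico_int _ _)]
  simp only [ico_val]

/-- the total variation of the classes satisfying alternative A is at
most `120·2^12·300·Var f`. -/
theorem stmt13 (f : ℤ → ℝ) (hf : ∀ n, 0 ≤ f n) (hbv : BddVar f)
    (σ : ℕ) (a b : ℕ → ℤ)
    (hab : ∀ i ∈ Finset.Icc 1 σ, a i < b i ∧ b i < a (i + 1))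
    (hM : ∀ i ∈ Finset.Icc 1 σ,
      dM f (a i) < dM f (b i) ∧ dM f (a (i + 1)) < dM f (b i))
    (S : Finset (ℕ × ℤ))
    (hS : ∀ c ∈ S, 6 ≤ c.1 ∧ (Enk f a b σ c.1 c.2).Nonempty ∧
      AltA f c.1 c.2 (varEnk f a b σ c.1 c.2)) :
    ∑ c ∈ S, varEnk f a b σ c.1 c.2 ≤ 120 * 2 ^ 12 * 300 * dVar f := by
  have hex : ∀ c : ℕ × ℤ, ∃ s α β t : ℤ, c ∈ S → (s < α ∧ β < t ∧
      (c.2 - 64) * 2 ^ (c.1 - 5) ≤ s ∧ t ≤ (c.2 + 65) * 2 ^ (c.1 - 5)) ∧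
      varEnk f a b σ c.1 c.2 ≤
        24 * ((∑ x ∈ Finset.Icc α β, max (min (f s) (f t) - f x) 0) / 2^(c.1-5)) := by
    intro c
    by_cases hc : c ∈ S
    swap
    · exact ⟨0, 0, 0, 0, fun h => absurd h hc⟩
    obtain ⟨-, -, s, α, β, γ, δ, t, h1, h2, h3, h4, h5, h6, h7, h8, h9, -, -, -, hV⟩ := hS c hc
    refine ⟨s, α, β, t, fun _ => ⟨⟨h1, by omega, h6, h7⟩, ?_⟩⟩
    set m := min (f s) (f t)
    have hV' : (1/24 : ℝ) * varEnk f a b σ c.1 c.2 ≤ m - avg f α β :=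
      hV.trans (sub_le_sub_left (le_max_left _ _) _)
    have hlen : (2:ℝ)^(c.1-5) ≤ ((β - α + 1 : ℤ) : ℝ) := by
      have : (2:ℤ)^(c.1-5) ≤ β - α + 1 := by linarith
      exact_mod_cast this
    have hpos : (0:ℝ) < 2^(c.1-5) := by positivity
    have hpos' : (0:ℝ) < ((β - α + 1 : ℤ) : ℝ) := hpos.trans_le hlen
    have hsum : m - avg f α β = (∑ x ∈ Finset.Icc α β, (m - f x)) / ((β - α + 1 : ℤ) : ℝ) := by
      rw [avg, Finset.sum_sub_distrib, Finset.sum_const, nsmul_eq_mul, sub_div]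
      have : ((Finset.Icc α β).card : ℝ) = ((β - α + 1 : ℤ) : ℝ) := by
        have : ((Finset.Icc α β).card : ℤ) = β - α + 1 := by simp; omega
        exact_mod_cast this
      rw [this, mul_div_cancel_left₀ _ hpos'.ne']
    have hle : m - avg f α β ≤
        (∑ x ∈ Finset.Icc α β, max (m - f x) 0) / 2^(c.1-5) := by
      rw [hsum]
      refine (div_le_div_of_nonneg_right
        (Finset.sum_le_sum fun x _ => le_max_left (m - f x) 0) hpos'.le).trans ?_
      exact div_le_div_of_nonneg_left (Finset.sum_nonneg fun _ _ => le_max_right _ _) hpos hlen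
    linarith
  choose s α β t hst using hex
  set W := S.biUnion fun c => Finset.Icc (s c) (t c) with hWdef
  have hlay := layer f S (fun c hc => (hS c hc).1) s α β t W (fun c hc => (hst c hc).1)
    (fun c hc => Finset.subset_biUnion_of_mem (fun c => Finset.Icc (s c) (t c)) hc)
  have hvar : ∑ p ∈ W, max (f p - f (p+1)) 0 ≤ dVar f := by
    refine (Finset.sum_le_sum (g := fun p => |f (p+1) - f p|) fun p _ => ?_).trans
      (hbv.sum_le_tsum W fun _ _ => abs_nonneg _)
    rw [abs_sub_comm]
    exact max_le (le_abs_self _) (abs_nonneg _)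
  have hnn : 0 ≤ dVar f := tsum_nonneg fun _ => abs_nonneg _
  have h1 := Finset.sum_le_sum fun c hc => (hst c hc).2
  rw [← Finset.mul_sum] at h1
  nlinarith

end
end
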